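/- arXiv:math/0106185 — 2 statements merged into one kernel-verified Lean document; each statement's English description precedes it below -/
import Mathlib

section
/- Let f ≥ 0 and n be integers with n ≤ 2f + 3, and let λ be a bipartition of n. Then, for the counts attached to the f-shifted path sequence of λ, one has 2f + 3 ≥ (b_l+d_l)(a_m+c_m+a_r+c_r) + (a_l+d_l+a_m+d_m)(b_r+c_r) + (b_m+d_m)(a_r+c_r) + (a_l+d_l)(b_m+c_m) + a_l·b_l + a_m·b_m + a_r·b_r. -/
/-- A partition: a non-increasing sequence of non-negative integers with finite sum.
Here `part i` is the `(i+1)`-st part `λ_{i+1}`. -/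
structure PartitionSeq : Type where
  part : ℕ → ℕ
  antitone' : ∀ {i j : ℕ}, i ≤ j → part j ≤ part i
  eventually_zero : ∃ N : ℕ, ∀ i : ℕ, N ≤ i → part i = 0

/-- The size `|λ| = Σ_i λ_i` of a partition. -/
noncomputable def PartitionSeq.size (μ : PartitionSeq) : ℕ := ∑ᶠ i : ℕ, μ.part i

open scoped Classical in
/-- The path sequence (Maya diagram) of a partition: `p_λ(i) = 0` if
`i = λ_j - j + 1` for some `j ≥ 1` (i.e. `i = part j - j` for some `j : ℕ` in the
0-indexed convention used here), and `p_λ(i) = 1` otherwise. -/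
noncomputable def PartitionSeq.path (μ : PartitionSeq) (i : ℤ) : ℕ :=
  if ∃ j : ℕ, i = (μ.part j : ℤ) - (j : ℤ) then 0 else 1

section PathCounts

variable (μ₁ μ₂ : PartitionSeq) (f : ℕ)

/-- Predicate: position `i` of the `f`-shifted path sequence of the bipartition
`(μ₁, μ₂)` carries the pair `A = (0,1)`. -/
def pairA (i : ℤ) : Prop := μ₁.path i = 0 ∧ μ₂.path (i - f) = 1

/-- Pair `B = (1,0)` at position `i`. -/
def pairB (i : ℤ) : Prop := μ₁.path i = 1 ∧ μ₂.path (i - f) = 0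

/-- Pair `C = (0,0)` at position `i`. -/
def pairC (i : ℤ) : Prop := μ₁.path i = 0 ∧ μ₂.path (i - f) = 0

/-- Pair `D = (1,1)` at position `i`. -/
def pairD (i : ℤ) : Prop := μ₁.path i = 1 ∧ μ₂.path (i - f) = 1

/-- The number of positions `i ≤ 0` (the left region) where `P` holds. -/
noncomputable def countL (P : ℤ → Prop) : ℕ := Set.ncard {i : ℤ | i ≤ 0 ∧ P i}

/-- The number of positions `1 ≤ i ≤ f` (the middle region) where `P` holds. -/
noncomputable def countM (P : ℤ → Prop) : ℕ :=
  Set.ncard {i : ℤ | 1 ≤ i ∧ i ≤ (f : ℤ) ∧ P i}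

/-- The number of positions `i > f` (the right region) where `P` holds. -/
noncomputable def countR (P : ℤ → Prop) : ℕ := Set.ncard {i : ℤ | (f : ℤ) < i ∧ P i}

end PathCounts

/-- An inversion of a `0`/`1` sequence: a `1` at a smaller position than a `0`. -/
def IsInversion (p : ℤ → ℕ) (x : ℤ × ℤ) : Prop := x.1 < x.2 ∧ p x.1 = 1 ∧ p x.2 = 0

namespace PartitionSeq

variable (μ : PartitionSeq)

theorem path_eq_zero_iff (i : ℤ) : μ.path i = 0 ↔ ∃ j : ℕ, i = (μ.part j : ℤ) - (j : ℤ) := by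
  unfold path
  split_ifs with h <;> simp [h]

theorem path_eq_one_iff (i : ℤ) : μ.path i = 1 ↔ ∀ j : ℕ, i ≠ (μ.part j : ℤ) - (j : ℤ) := by
  unfold path
  split_ifs with h <;> simpa using h

/-- There are at most `μ.part k` gaps between the `k`-th bead and a position `-N` below which
there are only beads. -/
theorem card_gaps_le {N k : ℕ} (hk : k < N) :
    ((Finset.Ioo (-(N : ℤ)) (μ.part k - k)).filter (fun i => μ.path i = 1)).card ≤ μ.part k := by
  set bead : ℕ → ℤ := fun m => (μ.part m : ℤ) - m with hbead
  have hinj : Function.Injective bead := by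
    intro a b hab
    simp only [hbead] at hab
    rcases le_total a b with h | h
    · have := μ.antitone' h
      omega
    · have := μ.antitone' h
      omega
  have hsub : (Finset.Ioo k N).image bead ⊆ Finset.Ioo (-(N : ℤ)) (μ.part k - k) := by
    intro i hi
    obtain ⟨m, hm, rfl⟩ := Finset.mem_image.1 hi
    rw [Finset.mem_Ioo] at hm ⊢
    have := μ.antitone' hm.1.le
    simp only [hbead]
    omega
  have hle : (Finset.Ioo (-(N : ℤ)) (μ.part k - k)).filter (fun i => μ.path i = 1) ⊆
      Finset.Ioo (-(N : ℤ)) (μ.part k - k) \ (Finset.Ioo k N).image bead := by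
    intro i hi
    rw [Finset.mem_filter, path_eq_one_iff] at hi
    refine Finset.mem_sdiff.2 ⟨hi.1, fun h => ?_⟩
    obtain ⟨m, -, rfl⟩ := Finset.mem_image.1 h
    exact hi.2 m rfl
  have hcard := Finset.card_le_card hle
  rw [Finset.card_sdiff_of_subset hsub, Finset.card_image_of_injective _ hinj, Int.card_Ioo,
    Nat.card_Ioo] at hcard
  omega

/-- A partition of `n` has at most `n` inversions in its path sequence. -/
theorem card_le_size_of_isInversion {I : Finset (ℤ × ℤ)}
    (hI : ∀ x ∈ I, IsInversion μ.path x) : I.card ≤ μ.size := by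
  obtain ⟨N, hN⟩ := μ.eventually_zero
  have hsize : μ.size = ∑ k ∈ Finset.range N, μ.part k := by
    refine finsum_eq_sum_of_support_subset _ fun k hk => ?_
    by_contra h
    exact hk (hN k (by simpa using h))
  have hsub : I ⊆ (Finset.range N).biUnion fun k =>
      ((Finset.Ioo (-(N : ℤ)) (μ.part k - k)).filter (fun i => μ.path i = 1)) ×ˢ
        {(μ.part k : ℤ) - k} := by
    rintro ⟨i, j⟩ hx
    obtain ⟨hij, hi, hj⟩ := hI _ hx
    dsimp only at hij hi hj
    obtain ⟨k, rfl⟩ := (μ.path_eq_zero_iff j).1 hj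
    have hlow : -(N : ℤ) < i := by
      by_contra! h
      refine (μ.path_eq_one_iff i).1 hi (-i).toNat ?_
      rw [hN _ (by omega)]
      omega
    have hkN : k < N := by
      by_contra! h
      have := hN k h
      omega
    simp only [Finset.mem_biUnion, Finset.mem_range, Finset.mem_product, Finset.mem_filter,
      Finset.mem_Ioo, Finset.mem_singleton]
    exact ⟨k, hkN, ⟨⟨hlow, hij⟩, hi⟩, rfl⟩
  rw [hsize]
  refine (Finset.card_le_card hsub).trans (Finset.card_biUnion_le.trans ?_)
  refine Finset.sum_le_sum fun k hk => ?_
  rw [Finset.card_product, Finset.card_singleton, mul_one]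
  exact μ.card_gaps_le (Finset.mem_range.1 hk)

theorem card_le_size_of_isInversion_shift (c : ℤ) {I : Finset (ℤ × ℤ)}
    (hI : ∀ x ∈ I, IsInversion (fun i => μ.path (i - c)) x) : I.card ≤ μ.size := by
  have hinj : Function.Injective fun x : ℤ × ℤ => (x.1 - c, x.2 - c) := by
    rintro ⟨a, b⟩ ⟨a', b'⟩ h
    simpa using h
  rw [← Finset.card_image_of_injective I hinj]
  refine μ.card_le_size_of_isInversion fun y hy => ?_
  obtain ⟨x, hx, rfl⟩ := Finset.mem_image.1 hy
  obtain ⟨h, h'⟩ := hI x hx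
  exact ⟨by dsimp only; omega, h'⟩

end PartitionSeq

/-- Cut `ℤ` into the intervals `(-∞, u]`, `(u, v]`, `(v, ∞)`: inversions between different
intervals and inversions inside each of them are all distinct. -/
theorem card_inversions_three_regions {p : ℤ → ℕ} {s : ℕ} {u v : ℤ} (huv : u ≤ v)
    (hp : ∀ I : Finset (ℤ × ℤ), (∀ x ∈ I, IsInversion p x) → I.card ≤ s)
    {X₁ X₂ Y₂ Y₃ : Finset ℤ} {E₁ E₂ E₃ : Finset (ℤ × ℤ)}
    (hX₁ : ∀ i ∈ X₁, i ≤ u ∧ p i = 1) (hX₂ : ∀ i ∈ X₂, u < i ∧ i ≤ v ∧ p i = 1)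
    (hY₂ : ∀ i ∈ Y₂, u < i ∧ i ≤ v ∧ p i = 0) (hY₃ : ∀ i ∈ Y₃, v < i ∧ p i = 0)
    (hE₁ : ∀ x ∈ E₁, IsInversion p x ∧ x.2 ≤ u)
    (hE₂ : ∀ x ∈ E₂, IsInversion p x ∧ u < x.1 ∧ x.2 ≤ v)
    (hE₃ : ∀ x ∈ E₃, IsInversion p x ∧ v < x.1) :
    X₁.card * (Y₂.card + Y₃.card) + X₂.card * Y₃.card + E₁.card + E₂.card + E₃.card ≤ s := by
  have hY : Disjoint Y₂ Y₃ := by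
    rw [Finset.disjoint_left]
    intro i h h'
    have := hY₂ i h
    have := hY₃ i h'
    omega
  have h₁ : Disjoint (X₁ ×ˢ (Y₂ ∪ Y₃)) (X₂ ×ˢ Y₃) := by
    rw [Finset.disjoint_left]
    rintro ⟨i, j⟩ h h'
    rw [Finset.mem_product] at h h'
    have := hX₁ i h.1
    have := hX₂ i h'.1
    omega
  have h₂ : Disjoint (X₁ ×ˢ (Y₂ ∪ Y₃) ∪ X₂ ×ˢ Y₃) E₁ := by
    rw [Finset.disjoint_left]
    rintro ⟨i, j⟩ h h'
    simp only [Finset.mem_union, Finset.mem_product] at h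
    have := hE₁ _ h'
    have := hY₂ j
    have := hY₃ j
    grind
  have h₃ : Disjoint (X₁ ×ˢ (Y₂ ∪ Y₃) ∪ X₂ ×ˢ Y₃ ∪ E₁) E₂ := by
    rw [Finset.disjoint_left]
    rintro ⟨i, j⟩ h h'
    simp only [Finset.mem_union, Finset.mem_product] at h
    have := hE₂ _ h'
    have := hE₁ (i, j)
    have := hX₁ i
    have := hY₃ j
    unfold IsInversion at *
    grind
  have h₄ : Disjoint (X₁ ×ˢ (Y₂ ∪ Y₃) ∪ X₂ ×ˢ Y₃ ∪ E₁ ∪ E₂) E₃ := by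
    rw [Finset.disjoint_left]
    rintro ⟨i, j⟩ h h'
    simp only [Finset.mem_union, Finset.mem_product] at h
    have := hE₃ _ h'
    have := hE₂ (i, j)
    have := hE₁ (i, j)
    have := hX₁ i
    have := hX₂ i
    unfold IsInversion at *
    grind
  have := hp (X₁ ×ˢ (Y₂ ∪ Y₃) ∪ X₂ ×ˢ Y₃ ∪ E₁ ∪ E₂ ∪ E₃) (by
    rintro ⟨i, j⟩ h
    simp only [Finset.mem_union, Finset.mem_product] at h
    have := hE₃ (i, j)
    have := hE₂ (i, j)
    have := hE₁ (i, j)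
    have := hX₁ i
    have := hX₂ i
    have := hY₂ j
    have := hY₃ j
    unfold IsInversion at *
    grind)
  rwa [Finset.card_union_of_disjoint h₄, Finset.card_union_of_disjoint h₃,
    Finset.card_union_of_disjoint h₂, Finset.card_union_of_disjoint h₁, Finset.card_product,
    Finset.card_product, Finset.card_union_of_disjoint hY] at this

theorem exists_finset_card_eq_ncard {α : Type*} (S : Set α) :
    ∃ F : Finset α, (∀ x ∈ F, x ∈ S) ∧ F.card = S.ncard := by
  rcases S.finite_or_infinite with h | h
  · exact ⟨h.toFinset, fun x hx => h.mem_toFinset.1 hx, (Set.ncard_eq_toFinset_card S h).symm⟩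
  · exact ⟨∅, by simp, by simp [h.ncard]⟩

/-- The pairs of a product of two disjoint finsets, split according to their order. -/
theorem card_mul_card_eq_of_disjoint {A B : Finset ℤ} (h : Disjoint A B) :
    A.card * B.card = ((B ×ˢ A).filter fun x => x.1 < x.2).card +
      ((A ×ˢ B).filter fun x => x.1 < x.2).card := by
  have hswap : ((A ×ˢ B).filter fun x => ¬ x.1 < x.2).card =
      ((B ×ˢ A).filter fun x => x.1 < x.2).card := by
    refine Finset.card_bij (fun x _ => x.swap) ?_ (fun _ _ _ _ hab => Prod.swap_injective hab) ?_
    · rintro ⟨i, j⟩ hx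
      simp only [Finset.mem_filter, Finset.mem_product, Prod.swap] at hx ⊢
      have : i ≠ j := fun hij => Finset.disjoint_left.1 h hx.1.1 (hij ▸ hx.1.2)
      exact ⟨hx.1.symm, by omega⟩
    · rintro ⟨i, j⟩ hx
      simp only [Finset.mem_filter, Finset.mem_product] at hx
      refine ⟨(j, i), ?_, rfl⟩
      simp only [Finset.mem_filter, Finset.mem_product]
      exact ⟨hx.1.symm, by omega⟩
  rw [← hswap, ← Finset.card_product, add_comm]
  exact (Finset.card_filter_add_card_filter_not _).symm

theorem path_counts_inequality
    (f n : ℕ) (hn : n ≤ 2 * f + 3) (μ₁ μ₂ : PartitionSeq)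
    (hsize : μ₁.size + μ₂.size = n) :
    (countL (pairB μ₁ μ₂ f) + countL (pairD μ₁ μ₂ f)) *
        (countM f (pairA μ₁ μ₂ f) + countM f (pairC μ₁ μ₂ f) +
          countR f (pairA μ₁ μ₂ f) + countR f (pairC μ₁ μ₂ f)) +
      (countL (pairA μ₁ μ₂ f) + countL (pairD μ₁ μ₂ f) +
          countM f (pairA μ₁ μ₂ f) + countM f (pairD μ₁ μ₂ f)) *
        (countR f (pairB μ₁ μ₂ f) + countR f (pairC μ₁ μ₂ f)) +
      (countM f (pairB μ₁ μ₂ f) + countM f (pairD μ₁ μ₂ f)) *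
        (countR f (pairA μ₁ μ₂ f) + countR f (pairC μ₁ μ₂ f)) +
      (countL (pairA μ₁ μ₂ f) + countL (pairD μ₁ μ₂ f)) *
        (countM f (pairB μ₁ μ₂ f) + countM f (pairC μ₁ μ₂ f)) +
      countL (pairA μ₁ μ₂ f) * countL (pairB μ₁ μ₂ f) +
      countM f (pairA μ₁ μ₂ f) * countM f (pairB μ₁ μ₂ f) +
      countR f (pairA μ₁ μ₂ f) * countR f (pairB μ₁ μ₂ f) ≤ 2 * f + 3 := by
  obtain ⟨Al, hAl, cAl⟩ : ∃ F : Finset ℤ,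
      (∀ i ∈ F, i ≤ 0 ∧ μ₁.path i = 0 ∧ μ₂.path (i - f) = 1) ∧
        F.card = countL (pairA μ₁ μ₂ f) := exists_finset_card_eq_ncard _
  obtain ⟨Bl, hBl, cBl⟩ : ∃ F : Finset ℤ,
      (∀ i ∈ F, i ≤ 0 ∧ μ₁.path i = 1 ∧ μ₂.path (i - f) = 0) ∧
        F.card = countL (pairB μ₁ μ₂ f) := exists_finset_card_eq_ncard _
  obtain ⟨Dl, hDl, cDl⟩ : ∃ F : Finset ℤ,
      (∀ i ∈ F, i ≤ 0 ∧ μ₁.path i = 1 ∧ μ₂.path (i - f) = 1) ∧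
        F.card = countL (pairD μ₁ μ₂ f) := exists_finset_card_eq_ncard _
  obtain ⟨Am, hAm, cAm⟩ : ∃ F : Finset ℤ,
      (∀ i ∈ F, 1 ≤ i ∧ i ≤ (f : ℤ) ∧ μ₁.path i = 0 ∧ μ₂.path (i - f) = 1) ∧
        F.card = countM f (pairA μ₁ μ₂ f) := exists_finset_card_eq_ncard _
  obtain ⟨Bm, hBm, cBm⟩ : ∃ F : Finset ℤ,
      (∀ i ∈ F, 1 ≤ i ∧ i ≤ (f : ℤ) ∧ μ₁.path i = 1 ∧ μ₂.path (i - f) = 0) ∧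
        F.card = countM f (pairB μ₁ μ₂ f) := exists_finset_card_eq_ncard _
  obtain ⟨Cm, hCm, cCm⟩ : ∃ F : Finset ℤ,
      (∀ i ∈ F, 1 ≤ i ∧ i ≤ (f : ℤ) ∧ μ₁.path i = 0 ∧ μ₂.path (i - f) = 0) ∧
        F.card = countM f (pairC μ₁ μ₂ f) := exists_finset_card_eq_ncard _
  obtain ⟨Dm, hDm, cDm⟩ : ∃ F : Finset ℤ,
      (∀ i ∈ F, 1 ≤ i ∧ i ≤ (f : ℤ) ∧ μ₁.path i = 1 ∧ μ₂.path (i - f) = 1) ∧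
        F.card = countM f (pairD μ₁ μ₂ f) := exists_finset_card_eq_ncard _
  obtain ⟨Ar, hAr, cAr⟩ : ∃ F : Finset ℤ,
      (∀ i ∈ F, (f : ℤ) < i ∧ μ₁.path i = 0 ∧ μ₂.path (i - f) = 1) ∧
        F.card = countR f (pairA μ₁ μ₂ f) := exists_finset_card_eq_ncard _
  obtain ⟨Br, hBr, cBr⟩ : ∃ F : Finset ℤ,
      (∀ i ∈ F, (f : ℤ) < i ∧ μ₁.path i = 1 ∧ μ₂.path (i - f) = 0) ∧
        F.card = countR f (pairB μ₁ μ₂ f) := exists_finset_card_eq_ncard _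
  obtain ⟨Cr, hCr, cCr⟩ : ∃ F : Finset ℤ,
      (∀ i ∈ F, (f : ℤ) < i ∧ μ₁.path i = 0 ∧ μ₂.path (i - f) = 0) ∧
        F.card = countR f (pairC μ₁ μ₂ f) := exists_finset_card_eq_ncard _
  rw [← cAl, ← cBl, ← cDl, ← cAm, ← cBm, ← cCm, ← cDm, ← cAr, ← cBr, ← cCr]
  have dBlDl : Disjoint Bl Dl :=
    Finset.disjoint_left.2 fun i h h' => by have := hBl i h; have := hDl i h'; omega
  have dBmDm : Disjoint Bm Dm :=
    Finset.disjoint_left.2 fun i h h' => by have := hBm i h; have := hDm i h'; omega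
  have dAmCm : Disjoint Am Cm :=
    Finset.disjoint_left.2 fun i h h' => by have := hAm i h; have := hCm i h'; omega
  have dArCr : Disjoint Ar Cr :=
    Finset.disjoint_left.2 fun i h h' => by have := hAr i h; have := hCr i h'; omega
  have dAlDl : Disjoint Al Dl :=
    Finset.disjoint_left.2 fun i h h' => by have := hAl i h; have := hDl i h'; omega
  have dAmDm : Disjoint Am Dm :=
    Finset.disjoint_left.2 fun i h h' => by have := hAm i h; have := hDm i h'; omega
  have dBmCm : Disjoint Bm Cm :=
    Finset.disjoint_left.2 fun i h h' => by have := hBm i h; have := hCm i h'; omega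
  have dBrCr : Disjoint Br Cr :=
    Finset.disjoint_left.2 fun i h h' => by have := hBr i h; have := hCr i h'; omega
  have dAlBl : Disjoint Al Bl :=
    Finset.disjoint_left.2 fun i h h' => by have := hAl i h; have := hBl i h'; omega
  have dAmBm : Disjoint Am Bm :=
    Finset.disjoint_left.2 fun i h h' => by have := hAm i h; have := hBm i h'; omega
  have dArBr : Disjoint Ar Br :=
    Finset.disjoint_left.2 fun i h h' => by have := hAr i h; have := hBr i h'; omega
  have inv₁ := card_inversions_three_regions (Int.natCast_nonneg f) (fun I => μ₁.card_le_size_of_isInversion)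
    (X₁ := Bl ∪ Dl)
    (X₂ := Bm ∪ Dm)
    (Y₂ := Am ∪ Cm)
    (Y₃ := Ar ∪ Cr)
    (E₁ := (Bl ×ˢ Al).filter fun x => x.1 < x.2)
    (E₂ := (Bm ×ˢ Am).filter fun x => x.1 < x.2)
    (E₃ := (Br ×ˢ Ar).filter fun x => x.1 < x.2)
    (by intro i hi; have := hBl i; have := hDl i; grind)
    (by intro i hi; have := hBm i; have := hDm i; grind)
    (by intro i hi; have := hAm i; have := hCm i; grind)
    (by intro i hi; have := hAr i; have := hCr i; grind)
    (by rintro ⟨i, j⟩ hx; have := hBl i; have := hAl j; unfold IsInversion; grind)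
    (by rintro ⟨i, j⟩ hx; have := hBm i; have := hAm j; unfold IsInversion; grind)
    (by rintro ⟨i, j⟩ hx; have := hBr i; have := hAr j; unfold IsInversion; grind)
  have inv₂ := card_inversions_three_regions (Int.natCast_nonneg f) (fun I => μ₂.card_le_size_of_isInversion_shift f)
    (X₁ := Al ∪ Dl)
    (X₂ := Am ∪ Dm)
    (Y₂ := Bm ∪ Cm)
    (Y₃ := Br ∪ Cr)
    (E₁ := (Al ×ˢ Bl).filter fun x => x.1 < x.2)
    (E₂ := (Am ×ˢ Bm).filter fun x => x.1 < x.2)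
    (E₃ := (Ar ×ˢ Br).filter fun x => x.1 < x.2)
    (by intro i hi; have := hAl i; have := hDl i; grind)
    (by intro i hi; have := hAm i; have := hDm i; grind)
    (by intro i hi; have := hBm i; have := hCm i; grind)
    (by intro i hi; have := hBr i; have := hCr i; grind)
    (by rintro ⟨i, j⟩ hx; have := hAl i; have := hBl j; unfold IsInversion; grind)
    (by rintro ⟨i, j⟩ hx; have := hAm i; have := hBm j; unfold IsInversion; grind)
    (by rintro ⟨i, j⟩ hx; have := hAr i; have := hBr j; unfold IsInversion; grind)
  rw [Finset.card_union_of_disjoint dBlDl, Finset.card_union_of_disjoint dBmDm,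
    Finset.card_union_of_disjoint dAmCm, Finset.card_union_of_disjoint dArCr] at inv₁
  rw [Finset.card_union_of_disjoint dAlDl, Finset.card_union_of_disjoint dAmDm,
    Finset.card_union_of_disjoint dBmCm, Finset.card_union_of_disjoint dBrCr] at inv₂
  rw [card_mul_card_eq_of_disjoint dAlBl, card_mul_card_eq_of_disjoint dAmBm,
    card_mul_card_eq_of_disjoint dArBr]
  linarith
end

section
/- Let f ≥ 0 and n be integers with n ≤ 2f + 3, and let λ be a bipartition of n. Then, for the counts attached to the f-shifted path sequence of λ, one has a_l + a_m + a_r ≤ 1; in particular at most one position of the f-shifted path sequence of λ carries the pair A = (0,1). -/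
theorem PartitionSeq.sum_part_le_size (μ : PartitionSeq) (s : Finset ℕ) :
    ∑ i ∈ s, μ.part i ≤ μ.size := by
  obtain ⟨N, hN⟩ := μ.eventually_zero
  have hsub : Function.support μ.part ⊆ ↑(s ∪ Finset.range N) := by
    intro i hi
    have : i < N := by
      by_contra h
      exact hi (hN i (not_lt.mp h))
    simp [this]
  rw [PartitionSeq.size, finsum_eq_sum_of_support_subset _ hsub]
  exact Finset.sum_le_sum_of_subset Finset.subset_union_left

theorem PartitionSeq.path_eq_zero_iff_s17 (μ : PartitionSeq) (i : ℤ) :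
    μ.path i = 0 ↔ ∃ j : ℕ, i = (μ.part j : ℤ) - j := by
  simp [PartitionSeq.path]

theorem PartitionSeq.path_eq_one_iff_s17 (μ : PartitionSeq) (i : ℤ) :
    μ.path i = 1 ↔ ∀ j : ℕ, i ≠ (μ.part j : ℤ) - j := by
  simp [PartitionSeq.path]

/-- The first column of a partition with `p(g) = 1` has length at least `1 - g`. -/
theorem PartitionSeq.one_le_part_of_path_eq_one (μ : PartitionSeq) {g : ℤ} (hg : μ.path g = 1)
    {r : ℕ} (hr : (r : ℤ) ≤ -g) : 1 ≤ μ.part r := by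
  rw [μ.path_eq_one_iff_s17] at hg
  have := hg (-g).toNat
  have := μ.antitone' (i := r) (j := (-g).toNat) (by omega)
  omega

/-- If `p(g) = p(h) = 1` with `g < h`, the second column has length at least `2 - h`. -/
theorem PartitionSeq.two_le_part_of_path_eq_one (μ : PartitionSeq) {g h : ℤ} (hg : μ.path g = 1)
    (hh : μ.path h = 1) (hgh : g < h) {r : ℕ} (hr : (r : ℤ) ≤ 1 - h) : 2 ≤ μ.part r := by
  have := μ.one_le_part_of_path_eq_one hg (r := (1 - h).toNat) (by omega)
  have := (μ.path_eq_one_iff_s17 h).mp hh (1 - h).toNat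
  have := μ.antitone' (i := r) (j := (1 - h).toNat) (by omega)
  omega

theorem PartitionSeq.le_size_of_path_eq_one (μ : PartitionSeq) {g h : ℤ} (hg : μ.path g = 1)
    (hh : μ.path h = 1) (hgh : g < h) : (1 - g).toNat + (2 - h).toNat ≤ μ.size := by
  have hle : (2 - h).toNat ≤ (1 - g).toNat := by omega
  calc (1 - g).toNat + (2 - h).toNat
      = ∑ r ∈ Finset.range (2 - h).toNat, 2 +
          ∑ r ∈ Finset.Ico (2 - h).toNat (1 - g).toNat, 1 := by
        simp only [Finset.sum_const, Finset.card_range, Nat.card_Ico, smul_eq_mul]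
        omega
    _ ≤ ∑ r ∈ Finset.range (2 - h).toNat, μ.part r +
          ∑ r ∈ Finset.Ico (2 - h).toNat (1 - g).toNat, μ.part r := by
        gcongr with r hr r hr
        · rw [Finset.mem_range] at hr
          exact μ.two_le_part_of_path_eq_one hg hh hgh (by omega)
        · rw [Finset.mem_Ico] at hr
          exact μ.one_le_part_of_path_eq_one hg (by omega)
    _ = ∑ r ∈ Finset.range (1 - g).toNat, μ.part r := Finset.sum_range_add_sum_Ico _ hle
    _ ≤ μ.size := μ.sum_part_le_size _

/-- Two positions carrying the pair `A` force the bipartition to have size at least `2f + 4`. -/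
theorem le_size_add_size_of_pairA {μ₁ μ₂ : PartitionSeq} {f : ℕ} {i j : ℤ}
    (hi : pairA μ₁ μ₂ f i) (hj : pairA μ₁ μ₂ f j) (hij : i < j) :
    2 * f + 4 ≤ μ₁.size + μ₂.size := by
  have h₂ := μ₂.le_size_of_path_eq_one hi.2 hj.2 (by omega)
  obtain ⟨a, ha⟩ := (μ₁.path_eq_zero_iff_s17 i).mp hi.1
  obtain ⟨b, hb⟩ := (μ₁.path_eq_zero_iff_s17 j).mp hj.1
  have hba : b < a := by
    by_contra h
    have := μ₁.antitone' (not_lt.mp h)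
    omega
  have h₁ := μ₁.sum_part_le_size {a, b}
  rw [Finset.sum_pair hba.ne'] at h₁
  omega

theorem countL_add_countM_add_countR_le_one (f : ℕ) {P : ℤ → Prop}
    (hP : ∀ i j : ℤ, P i → P j → i = j) : countL P + countM f P + countR f P ≤ 1 := by
  have hs : {i | P i}.Subsingleton := fun i hi j hj => hP i j hi hj
  have hL : {i : ℤ | i ≤ 0 ∧ P i}.Finite := hs.finite.subset fun _ h => h.2
  have hM : {i : ℤ | 1 ≤ i ∧ i ≤ (f : ℤ) ∧ P i}.Finite := hs.finite.subset fun _ h => h.2.2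
  have hR : {i : ℤ | (f : ℤ) < i ∧ P i}.Finite := hs.finite.subset fun _ h => h.2
  rw [countL, countM, countR, ← Set.ncard_union_eq _ hL hM,
    ← Set.ncard_union_eq _ (hL.union hM) hR]
  · have := hs.finite.to_subtype
    refine (Set.ncard_le_ncard ?_ hs.finite).trans (Set.ncard_le_one_iff_subsingleton.mpr hs)
    rintro i ((h | h) | h)
    exacts [h.2, h.2.2, h.2]
  · rw [Set.disjoint_left]
    rintro i (h | h) h' <;> simp only [Set.mem_ofPred_eq] at h h' <;> omega
  · rw [Set.disjoint_left]
    rintro i h h'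
    simp only [Set.mem_ofPred_eq] at h h'
    omega

theorem path_counts_a_le_one
    (f n : ℕ) (hn : n ≤ 2 * f + 3) (μ₁ μ₂ : PartitionSeq)
    (hsize : μ₁.size + μ₂.size = n) :
    (countL (pairA μ₁ μ₂ f) + countM f (pairA μ₁ μ₂ f) + countR f (pairA μ₁ μ₂ f) ≤ 1) ∧
      ∀ i j : ℤ, pairA μ₁ μ₂ f i → pairA μ₁ μ₂ f j → i = j := by
  have hA : ∀ i j : ℤ, pairA μ₁ μ₂ f i → pairA μ₁ μ₂ f j → i = j := by
    intro i j hi hj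
    rcases lt_trichotomy i j with h | h | h
    · have := le_size_add_size_of_pairA hi hj h
      omega
    · exact h
    · have := le_size_add_size_of_pairA hj hi h
      omega
  exact ⟨countL_add_countM_add_countR_le_one f hA, hA⟩
end
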